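/- Quaternionic Dieudonné estimate: let f be a slice regular self-map of 𝔹 with f(0) = 0, and let q₀ ∈ 𝔹 with q₀ ≠ 0. Set α_f(q₀) = (1 − |f(q₀)|²)/(1 − |q₀|²). Then |α_f(q₀)·f^h(q₀) − q₀⁻¹ f(q₀)| ≤ (|q₀|² − |f(q₀)|²)/(|q₀|(1 − |q₀|²)). -/

import Mathlib

noncomputable section

abbrev H : Type := Quaternion ℝ

namespace QPaper

/-- The complex slice determined by `I`: the real span of `1` and `I`. -/
def sliceSet (I : H) : Set H := {q | ∃ x y : ℝ, q = (x : H) + y • I}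

/-- Evaluation of the power series `q ↦ ∑ qᵐ aₘ` with right coefficients. -/
def evalC (a : ℕ → H) (q : H) : H := ∑' m, q ^ m * a m

/-- The series with coefficients `a` converges at every point of the unit ball. -/
def SummableOn (a : ℕ → H) : Prop := ∀ q : H, ‖q‖ < 1 → Summable fun m => q ^ m * a m

/-- `a` are the coefficients of a slice regular self-map of the unit ball. -/
def SelfMap (a : ℕ → H) : Prop :=
  SummableOn a ∧ ∀ q : H, ‖q‖ < 1 → ‖evalC a q‖ < 1

/-- Coefficients of the ∗-product. -/
def starMulC (a b : ℕ → H) : ℕ → H := fun m => ∑ ℓ ∈ Finset.range (m + 1), a (m - ℓ) * b ℓ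

/-- Coefficients of the ∗-inverse (of a series with invertible constant term). -/
def starInvC (a : ℕ → H) : ℕ → H
  | 0 => (a 0)⁻¹
  | m + 1 => -(a 0)⁻¹ * ∑ ℓ : Fin (m + 1), a (m + 1 - ℓ.val) * starInvC a ℓ.val
  decreasing_by exact ℓ.isLt

/-- Coefficients of `1 - q p̄`. -/
def oneMinusQPbarC (p : H) : ℕ → H := fun m => if m = 0 then 1 else if m = 1 then -(star p) else 0

/-- Coefficients of `q - p`. -/
def qMinusPC (p : H) : ℕ → H := fun m => if m = 0 then -p else if m = 1 then 1 else 0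

/-- Coefficients of the regular Möbius transformation `ℳ_p = (1 - q p̄)^{-∗} ∗ (q - p)`. -/
def mobiusC (p : H) : ℕ → H := starMulC (starInvC (oneMinusQPbarC p)) (qMinusPC p)

/-- Coefficients of `ℳ_{t₁} ∗ ⋯ ∗ ℳ_{t_κ}`. -/
def blaschkeListC : List H → (ℕ → H)
  | [] => fun m => if m = 0 then 1 else 0
  | t :: ts => starMulC (mobiusC t) (blaschkeListC ts)

/-- `a` are the coefficients of a regular Blaschke product of degree `κ`,
i.e. of `ℳ_{t₁} ∗ ⋯ ∗ ℳ_{t_κ} u` with the `tᵢ` in `𝔹` and `u` unimodular. -/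
def IsBlaschke (a : ℕ → H) (κ : ℕ) : Prop :=
  ∃ (ts : List H) (u : H), ts.length = κ ∧ (∀ t ∈ ts, ‖t‖ < 1) ∧ ‖u‖ = 1 ∧
    a = fun m => blaschkeListC ts m * u

/-- Coefficients of `ℳ_w ∙ f = (1 - f w̄)^{-∗} ∗ (f - w)`. -/
def bulletC (w : H) (a : ℕ → H) : ℕ → H :=
  starMulC (starInvC (fun m => (if m = 0 then (1 : H) else 0) - a m * star w))
    (fun m => a m - if m = 0 then w else 0)

/-- Coefficients of the regular difference quotient `ℛ_{f,p}`,
the unique slice regular function with `f(q) = f(p) + (q - p) ∗ ℛ_{f,p}(q)`. -/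
def diffQuotC (a : ℕ → H) (p : H) : ℕ → H := fun m => ∑' k, p ^ k * a (k + m + 1)

/-- Coefficients of the hyperbolic difference quotient
`f⋆_p = (1 - q p̄) ∗ ℛ_{f,p} ∗ (1 - \overline{f(p)} f)^{-∗} = ℳ_p^{-∗} ∗ (ℳ_{f(p)} ∙ f)`. -/
def hdqC (a : ℕ → H) (p : H) : ℕ → H :=
  starMulC (starMulC (oneMinusQPbarC p) (diffQuotC a p))
    (starInvC (fun m => (if m = 0 then (1 : H) else 0) - star (evalC a p) * a m))

/-- Iterated hyperbolic difference quotients: `ihdqC a [p₁, …, pₙ] = ((f⋆_{p₁})⋆_{p₂} ⋯)⋆_{pₙ}`. -/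
def ihdqC (a : ℕ → H) : List H → (ℕ → H)
  | [] => a
  | p :: ps => ihdqC (hdqC a p) ps

/-- `𝒯_p(q) = (1 - q p)⁻¹ q (1 - q p)`. -/
def mobiusT (p q : H) : H := (1 - q * p)⁻¹ * q * (1 - q * p)

/-- `M_p(q) = (1 - q p̄)⁻¹ (q - p)`. -/
def mobiusM (p q : H) : H := (1 - q * star p)⁻¹ * (q - p)

/-- Pointwise evaluation of the regular Möbius transformation: `ℳ_p(q) = M_p(𝒯_p(q))`. -/
def mobiusEval (p q : H) : H := mobiusM p (mobiusT p q)

/-- The pseudo-hyperbolic distance `ρ(p,q) = |M_p(q)|`. -/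
def rho (p q : H) : ℝ := ‖mobiusM p q‖

/-- The Poincaré distance `δ(p,q) = tanh⁻¹ ρ(p,q) = ½ log((1+ρ)/(1−ρ))`. -/
def pdist (p q : H) : ℝ := (1/2 : ℝ) * Real.log ((1 + rho p q) / (1 - rho p q))


open Filter Topology
theorem nsq (q : H) : Quaternion.normSq q = ‖q‖ ^ 2 := by rw [Quaternion.normSq_eq_norm_mul_self, sq]

abbrev ImU : Type := {J : H // J * J = -1}

def iot (J : ImU) : ℂ →ₐ[ℝ] H := Complex.lift J

theorem iot_apply (J : ImU) (z : ℂ) : iot J z = (z.re : H) + z.im • J.1 := by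
  simp [iot, Complex.lift_apply, Complex.liftAux_apply]

theorem norm_iot (J : ImU) (z : ℂ) : ‖iot J z‖ = ‖z‖ := by
  obtain ⟨J, hJ⟩ := J
  have h1 : (J * J).re = (-1 : H).re := by rw [hJ]
  have h2 : (J * J).imI = (-1 : H).imI := by rw [hJ]
  have h3 : (J * J).imJ = (-1 : H).imJ := by rw [hJ]
  have h4 : (J * J).imK = (-1 : H).imK := by rw [hJ]
  rw [Quaternion.re_neg, Quaternion.re_one, Quaternion.re_mul] at h1
  rw [Quaternion.imI_neg, Quaternion.imI_one, Quaternion.imI_mul] at h2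
  rw [Quaternion.imJ_neg, Quaternion.imJ_one, Quaternion.imJ_mul] at h3
  rw [Quaternion.imK_neg, Quaternion.imK_one, Quaternion.imK_mul] at h4
  have hre : J.re = 0 := by
    by_contra h
    have e2 : J.imI = 0 := by
      have : J.re * J.imI = 0 := by linarith
      simpa [h] using this
    have e3 : J.imJ = 0 := by
      have : J.re * J.imJ = 0 := by linarith
      simpa [h] using this
    have e4 : J.imK = 0 := by
      have : J.re * J.imK = 0 := by linarith
      simpa [h] using this
    rw [e2, e3, e4] at h1
    nlinarith
  have : ‖iot ⟨J, hJ⟩ z‖ ^ 2 = ‖z‖ ^ 2 := by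
    rw [iot_apply, ← nsq , Complex.sq_norm, Complex.normSq_apply, Quaternion.normSq_def']
    simp [hre]
    rw [hre] at h1
    linear_combination (-z.im ^ 2) * h1
  exact (sq_eq_sq₀ (norm_nonneg _) (norm_nonneg _)).1 this

theorem exists_iot (p : H) : ∃ J : ImU, ∃ z : ℂ, iot J z = p := by
  by_cases h : p.im = 0
  · refine ⟨⟨((Complex.I : ℂ) : H), by rw [← Quaternion.coeComplex_mul, Complex.I_mul_I]; have := map_neg Quaternion.ofComplex 1; rwa [map_one] at this⟩, (p.re : ℂ), ?_⟩
    rw [iot_apply]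
    conv_rhs => rw [← Quaternion.re_add_im p, h]
    simp
  · have hn : ‖p.im‖ ≠ 0 := norm_ne_zero_iff.2 h
    refine ⟨⟨‖p.im‖⁻¹ • p.im, ?_⟩, ⟨p.re, ‖p.im‖⟩, ?_⟩
    · have : p.im * p.im = -((‖p.im‖ * ‖p.im‖ : ℝ) : H) := by
        have h1 : star p.im = - p.im := by simp
        have h2 := Quaternion.self_mul_star p.im
        rw [h1, Quaternion.normSq_eq_norm_mul_self] at h2
        rw [← h2]; simp
      rw [smul_mul_smul_comm, this, ← Quaternion.coe_neg, Quaternion.smul_coe]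
      rw [show ‖p.im‖⁻¹ * ‖p.im‖⁻¹ * -(‖p.im‖ * ‖p.im‖) = -1 by field_simp]
      simp
    · rw [iot_apply]
      simp only [smul_smul, mul_inv_cancel₀ hn, one_smul]
      exact Quaternion.re_add_im p

def V (_ : ImU) : Type := H

instance (J : ImU) : NormedAddCommGroup (V J) := inferInstanceAs (NormedAddCommGroup H)
instance (J : ImU) : CompleteSpace (V J) := inferInstanceAs (CompleteSpace H)
instance (J : ImU) : Nontrivial (V J) := inferInstanceAs (Nontrivial H)
instance (J : ImU) : Module ℂ (V J) := Module.compHom H (iot J).toRingHom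
instance (J : ImU) : NormedSpace ℂ (V J) where
  norm_smul_le z v := by
    change ‖iot J z * (show H from v)‖ ≤ _
    rw [norm_mul, norm_iot]; exact le_rfl

def toV (J : ImU) (y : H) : V J := y
def ofV {J : ImU} (y : V J) : H := y

theorem ofV_smul {J : ImU} (z : ℂ) (y : V J) : ofV (z • y) = iot J z * ofV y := rfl
theorem norm_ofV {J : ImU} (y : V J) : ‖ofV y‖ = ‖y‖ := rfl
theorem ofV_add {J : ImU} (y x : V J) : ofV (y + x) = ofV y + ofV x := rfl
theorem ofV_sub {J : ImU} (y x : V J) : ofV (y - x) = ofV y - ofV x := rfl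
theorem ofV_inj {J : ImU} {y x : V J} (h : ofV y = ofV x) : y = x := h
theorem ofV_toV {J : ImU} (y : H) : ofV (toV J y) = y := rfl

def ofVHom (J : ImU) : V J →+ H where
  toFun := ofV
  map_zero' := rfl
  map_add' _ _ := rfl

theorem continuous_ofV {J : ImU} : Continuous (ofVHom J) := continuous_id (X := H)

/-- right multiplication -/
def Rm (J : ImU) (b : H) : V J →L[ℂ] V J :=
  LinearMap.mkContinuous
    { toFun := fun y => toV J (ofV y * b)
      map_add' := fun x y => by
        apply ofV_inj; simp only [ofV_toV, ofV_add, add_mul]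
      map_smul' := fun z y => by
        apply ofV_inj; simp only [ofV_toV, ofV_smul, mul_assoc, RingHom.id_apply] } ‖b‖
    (fun y => by
      change ‖ofV y * b‖ ≤ _
      rw [norm_mul, norm_ofV, mul_comm])

theorem ofV_Rm {J : ImU} (b : H) (y : V J) : ofV (Rm J b y) = ofV y * b := rfl
theorem norm_Rm_le (J : ImU) (b : H) : ‖Rm J b‖ ≤ ‖b‖ :=
  LinearMap.mkContinuous_norm_le _ (norm_nonneg _) _

def Good (a : ℕ → H) : Prop := ∀ ρ : ℝ, 0 ≤ ρ → ρ < 1 → Summable fun k => ρ ^ k * ‖a k‖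

theorem SummableOn.good {a : ℕ → H} (h : SummableOn a) : Good a := by
  intro ρ h0 h1
  have := h (ρ : H) (by simpa [abs_of_nonneg h0] using h1)
  rw [← summable_norm_iff] at this
  simpa [abs_of_nonneg h0] using this

/-- operator of a series -/
def Op (J : ImU) (a : ℕ → H) (z : ℂ) : V J →L[ℂ] V J := ∑' k, z ^ k • Rm J (a k)

theorem norm_term_le (J : ImU) (a : ℕ → H) (z : ℂ) (k : ℕ) :
    ‖z ^ k • Rm J (a k)‖ ≤ ‖z‖ ^ k * ‖a k‖ := by
  rw [norm_smul, norm_pow]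
  gcongr
  exact norm_Rm_le _ _

theorem Op_hasSum (J : ImU) {a : ℕ → H} (h : Good a) {z : ℂ} (hz : ‖z‖ < 1) :
    HasSum (fun k => z ^ k • Rm J (a k)) (Op J a z) := by
  apply Summable.hasSum
  exact Summable.of_norm_bounded (h ‖z‖ (norm_nonneg _) hz) (norm_term_le J a z)

theorem Op_apply_hasSum (J : ImU) {a : ℕ → H} (h : Good a) {z : ℂ} (hz : ‖z‖ < 1) (y : V J) :
    HasSum (fun k => iot J z ^ k * (ofV y * a k)) (ofV (Op J a z y)) := by
  have h1 := (Op_hasSum J h hz).mapL (ContinuousLinearMap.apply ℂ (V J) y)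
  have h2 := h1.map (ofVHom J) continuous_ofV
  convert h2 using 1
  · ext1 k
    change _ = ofV (z ^ k • Rm J (a k) y)
    rw [ofV_smul, ofV_Rm, map_pow]
  · rfl

theorem Op_diff (J : ImU) {a : ℕ → H} (h : Good a) :
    DifferentiableOn ℂ (Op J a) (Metric.ball 0 1) := by
  intro z hz
  rw [mem_ball_zero_iff] at hz
  obtain ⟨ρ, h1, h2⟩ := exists_between hz
  have h0 : 0 ≤ ρ := (norm_nonneg _).trans h1.le
  have : DifferentiableOn ℂ (Op J a) (Metric.ball 0 ρ) := by
    refine Complex.differentiableOn_tsum_of_summable_norm (h ρ h0 h2) ?_ Metric.isOpen_ball ?_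
    · intro i; fun_prop
    · intro i w hw
      rw [mem_ball_zero_iff] at hw
      refine (norm_term_le J a w i).trans ?_
      gcongr
  exact (this.differentiableAt (Metric.isOpen_ball.mem_nhds (by simpa using h1))).differentiableWithinAt

theorem key_eq (u y w : H) :
    ‖y - u * star w‖ ^ 2 - ‖u - y * w‖ ^ 2 = (1 - ‖w‖ ^ 2) * (‖y‖ ^ 2 - ‖u‖ ^ 2) := by
  simp only [← nsq, Quaternion.normSq_def']
  simp
  ring

theorem key_ineq (u y w : H) (hw : ‖w‖ ≤ 1) (h : ‖u‖ ≤ ‖y‖) : ‖u - y * w‖ ≤ ‖y - u * star w‖ := by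
  have h1 := key_eq u y w
  have h2 : 0 ≤ 1 - ‖w‖ ^ 2 := by nlinarith [norm_nonneg w]
  have h3 : 0 ≤ ‖y‖ ^ 2 - ‖u‖ ^ 2 := by nlinarith [norm_nonneg u]
  have := mul_nonneg h2 h3
  exact (sq_le_sq₀ (norm_nonneg _) (norm_nonneg _)).1 (by linarith)

theorem diffQuot_bound {a : ℕ → H} (h : Good a) {p : H} (hp : ‖p‖ < 1) {σ : ℝ} (h1 : ‖p‖ < σ)
    (h2 : σ < 1) : ∃ C : ℝ, ∀ m, σ ^ m * ‖diffQuotC a p m‖ ≤ C := by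
  have h0 : 0 < σ := (norm_nonneg _).trans_lt h1
  have hs := h σ h0.le h2
  refine ⟨σ⁻¹ * ∑' k, σ ^ k * ‖a k‖, fun m => ?_⟩
  have hs' : Summable fun k => σ ^ (k + (m + 1)) * ‖a (k + (m + 1))‖ :=
    (summable_nat_add_iff (f := fun k => σ ^ k * ‖a k‖) (m + 1)).2 hs
  have e1 : ∑' k, σ ^ (k + (m + 1)) * ‖a (k + (m + 1))‖ ≤ ∑' k, σ ^ k * ‖a k‖ := by
    rw [← hs.sum_add_tsum_nat_add (m + 1)]
    have : 0 ≤ ∑ i ∈ Finset.range (m + 1), σ ^ i * ‖a i‖ :=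
      Finset.sum_nonneg fun i _ => by positivity
    linarith
  have e2 : ‖diffQuotC a p m‖ ≤ ∑' k, (σ ^ (m + 1))⁻¹ * (σ ^ (k + (m + 1)) * ‖a (k + (m + 1))‖) := by
    refine tsum_of_norm_bounded (hs'.mul_left _).hasSum fun k => ?_
    rw [norm_mul, norm_pow, pow_add σ k (m + 1)]
    have : (σ ^ (m + 1))⁻¹ * (σ ^ k * σ ^ (m + 1) * ‖a (k + (m + 1))‖) = σ ^ k * ‖a (k + (m+1))‖ := by
      field_simp
    rw [this, ← add_assoc]
    gcongr
  rw [tsum_mul_left] at e2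
  calc σ ^ m * ‖diffQuotC a p m‖ ≤ σ ^ m * ((σ ^ (m + 1))⁻¹ * ∑' k, σ ^ k * ‖a k‖) := by
        gcongr
        exact e2.trans (by gcongr)
    _ = _ := by rw [pow_succ]; field_simp

theorem diffQuot_good {a : ℕ → H} (h : Good a) {p : H} (hp : ‖p‖ < 1) : Good (diffQuotC a p) := by
  intro ρ h0 h1
  obtain ⟨σ, hσ, hσ1⟩ := exists_between (max_lt hp h1)
  obtain ⟨hpσ, hρσ⟩ := max_lt_iff.1 hσ
  obtain ⟨C, hC⟩ := diffQuot_bound h hp hpσ hσ1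
  have hσ0 : 0 < σ := h0.trans_lt hρσ
  have : Summable fun k => (ρ / σ) ^ k * C :=
    (summable_geometric_of_lt_one (by positivity) ((div_lt_one hσ0).2 hρσ)).mul_right C
  refine Summable.of_nonneg_of_le (fun k => by positivity) (fun k => ?_) this
  calc ρ ^ k * ‖diffQuotC a p k‖ = (ρ / σ) ^ k * (σ ^ k * ‖diffQuotC a p k‖) := by
        rw [div_pow]; field_simp
    _ ≤ _ := by gcongr; exact hC k

theorem Good.summable {a : ℕ → H} (h : Good a) {p : H} (hp : ‖p‖ < 1) (j : ℕ) :
    Summable fun k => p ^ k * a (k + j) := by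
  induction j with
  | zero =>
    refine Summable.of_norm ?_
    simpa [norm_mul, norm_pow] using h ‖p‖ (norm_nonneg _) hp
  | succ j ih =>
    by_cases hp0 : p = 0
    · subst hp0
      refine summable_of_ne_finset_zero (s := {0}) ?_
      intro b hb
      simp at hb
      simp [hb]
    · have := (summable_nat_add_iff (f := fun k => p ^ k * a (k + j)) 1).2 ih
      have := this.mul_left p⁻¹
      refine this.congr fun k => ?_
      rw [pow_succ', mul_assoc, inv_mul_cancel_left₀ hp0]
      congr 2
      ring

theorem diffQuot_rec {a : ℕ → H} (h : Good a) {p : H} (hp : ‖p‖ < 1) (m : ℕ) :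
    diffQuotC a p m = a (m + 1) + p * diffQuotC a p (m + 1) := by
  unfold diffQuotC
  have := h.summable hp (m + 1)
  simp only [← add_assoc] at this
  rw [this.tsum_eq_zero_add, ← tsum_mul_left]
  simp only [pow_zero, one_mul, zero_add, pow_succ', mul_assoc]
  congr 3
  ext1 k
  congr 3
  ring

theorem diffQuot_zero {a : ℕ → H} (h : Good a) {p : H} (hp : ‖p‖ < 1) :
    evalC a p = a 0 + p * diffQuotC a p 0 := by
  unfold diffQuotC evalC
  have := h.summable hp 0
  simp only [add_zero] at this
  rw [this.tsum_eq_zero_add, ← tsum_mul_left]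
  simp only [pow_zero, one_mul, pow_succ', mul_assoc, add_zero]

/-- `Φ_R (z - R_p) = Φ - R_w`. -/
theorem Op_diffQuot (J : ImU) {a : ℕ → H} (h : Good a) {p : H} (hp : ‖p‖ < 1) {z : ℂ}
    (hz : ‖z‖ < 1) (y : V J) :
    Op J (diffQuotC a p) z (z • y - Rm J p y) = Op J a z y - Rm J (evalC a p) y := by
  apply ofV_inj
  have hR := diffQuot_good h hp
  have s1 := Op_apply_hasSum J hR hz (z • y)
  have s2 := Op_apply_hasSum J hR hz (Rm J p y)
  have s3 := Op_apply_hasSum J h hz y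
  rw [map_sub, ofV_sub, ofV_sub, ofV_Rm]
  rw [← s1.tsum_eq, ← s2.tsum_eq, ← s3.tsum_eq, s2.summable.tsum_eq_zero_add,
    s3.summable.tsum_eq_zero_add, ← sub_sub, sub_right_comm, diffQuot_zero h hp]
  have s2' := (summable_nat_add_iff 1).2 s2.summable
  rw [← s1.summable.tsum_sub s2']
  simp only [pow_zero, one_mul, ofV_Rm, ofV_smul]
  have : ∀ b, (iot J z ^ b * (iot J z * ofV y * diffQuotC a p b) -
      iot J z ^ (b + 1) * (ofV y * p * diffQuotC a p (b + 1))) =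
      iot J z ^ (b+1) * (ofV y * a (b + 1)) := by
    intro b
    rw [diffQuot_rec h hp b, pow_succ]
    noncomm_ring
  simp only [this]
  noncomm_ring

theorem Op_norm_le (J : ImU) {a : ℕ → H} (ha : SelfMap a) {z : ℂ} (hz : ‖z‖ < 1) :
    ‖Op J a z‖ ≤ 1 := by
  refine ContinuousLinearMap.opNorm_le_bound _ zero_le_one fun y => ?_
  by_cases hy : y = 0
  · simp [hy]
  have hy' : ofV y ≠ 0 := hy
  have s := Op_apply_hasSum J ha.1.good hz y
  set q : H := (ofV y)⁻¹ * iot J z * ofV y with hq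
  have hqn : ‖q‖ < 1 := by
    rw [hq, norm_mul, norm_mul, norm_inv, norm_iot, mul_right_comm, inv_mul_cancel₀ (norm_ne_zero_iff.2 hy'), one_mul]
    exact hz
  have hpow : ∀ k, ofV y * q ^ k = iot J z ^ k * ofV y := by
    intro k
    induction k with
    | zero => simp
    | succ k ih =>
      rw [pow_succ, ← mul_assoc, ih, hq, pow_succ]
      simp only [mul_assoc]
      rw [mul_inv_cancel_left₀ hy']
  have e : ofV (Op J a z y) = ofV y * evalC a q := by
    rw [← s.tsum_eq, evalC, ← tsum_mul_left]
    congr 1; ext1 k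
    rw [← mul_assoc, ← mul_assoc, hpow]
  rw [← norm_ofV, e, norm_mul, norm_ofV, one_mul]
  exact mul_le_of_le_one_right (norm_nonneg _) (ha.2 q hqn).le

/-- Solving: contraction lemma. -/
theorem contr (J : ImU) (A : V J →L[ℂ] V J) (hA : ‖A‖ ≤ 1) (w : H) (hw : ‖w‖ < 1) (y : V J) :
    ‖A y - Rm J w y‖ ≤ ‖y - Rm J (star w) (A y)‖ := by
  refine key_ineq (ofV (A y)) (ofV y) w hw.le ?_
  exact (A.le_opNorm y).trans (mul_le_of_le_one_left (norm_nonneg _) hA)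

theorem unit1 (J : ImU) (A : V J →L[ℂ] V J) (hA : ‖A‖ ≤ 1) (w : H) (hw : ‖w‖ < 1) :
    IsUnit (1 - A * Rm J (star w)) ∧ IsUnit (1 - Rm J (star w) * A) := by
  have h : ‖Rm J (star w)‖ < 1 := (norm_Rm_le _ _).trans_lt (by simpa using hw)
  constructor
  · apply isUnit_one_sub_of_norm_lt_one
    exact (norm_mul_le _ _).trans_lt (by nlinarith [norm_nonneg A, norm_nonneg (Rm J (star w))])
  · apply isUnit_one_sub_of_norm_lt_one
    exact (norm_mul_le _ _).trans_lt (by nlinarith [norm_nonneg A, norm_nonneg (Rm J (star w))])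

def Theta (J : ImU) (a : ℕ → H) (p : H) (z : ℂ) : V J →L[ℂ] V J :=
  Ring.inverse (1 - Op J a z * Rm J (star (evalC a p))) *
    (Op J (diffQuotC a p) z * (1 - z • Rm J (star p)))

theorem Theta_spec (J : ImU) {a : ℕ → H} (ha : SelfMap a) {p : H} (hp : ‖p‖ < 1) {z : ℂ}
    (hz : ‖z‖ < 1) :
    (1 - Op J a z * Rm J (star (evalC a p))) * Theta J a p z =
      Op J (diffQuotC a p) z * (1 - z • Rm J (star p)) := by
  have := (unit1 J (Op J a z) (Op_norm_le J ha hz) (evalC a p) (ha.2 p hp)).1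
  rw [Theta, ← mul_assoc, Ring.mul_inverse_cancel _ this, one_mul]

theorem Theta_diff (J : ImU) {a : ℕ → H} (ha : SelfMap a) {p : H} (hp : ‖p‖ < 1) :
    DifferentiableOn ℂ (Theta J a p) (Metric.ball 0 1) := by
  have hA := Op_diff J ha.1.good
  have hR := Op_diff J (diffQuot_good ha.1.good hp)
  have h1 : DifferentiableOn ℂ (fun z => 1 - Op J a z * Rm J (star (evalC a p)))
      (Metric.ball 0 1) := (differentiableOn_const _).sub (hA.mul (differentiableOn_const _))
  have h2 : DifferentiableOn ℂ (fun z => Ring.inverse (1 - Op J a z * Rm J (star (evalC a p))))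
      (Metric.ball 0 1) := by
    intro z hz
    have := (unit1 J (Op J a z) (Op_norm_le J ha (mem_ball_zero_iff.1 hz)) (evalC a p) (ha.2 p hp)).1
    exact (differentiableAt_inverse this).comp_differentiableWithinAt z (h1 z hz)
  have h3 : DifferentiableOn ℂ (fun z : ℂ => 1 - z • Rm J (star p)) (Metric.ball 0 1) := by
    fun_prop
  exact h2.mul (hR.mul h3)

def Kf (r ρ : ℝ) : ℝ := √(1 + (1 - r ^ 2) * (1 - ρ ^ 2) / (ρ - r) ^ 2)

theorem Theta_bound (J : ImU) {a : ℕ → H} (ha : SelfMap a) {p : H} (hp : ‖p‖ < 1) {z : ℂ}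
    (hz : ‖z‖ < 1) (hpz : ‖p‖ < ‖z‖) : ‖Theta J a p z‖ ≤ Kf ‖p‖ ‖z‖ := by
  refine ContinuousLinearMap.opNorm_le_bound _ (Real.sqrt_nonneg _) fun y => ?_
  set w := evalC a p with hw
  set A := Op J a z with hAdef
  have hwn : ‖w‖ < 1 := ha.2 p hp
  have hA : ‖A‖ ≤ 1 := Op_norm_le J ha hz
  have hU := unit1 J A hA w hwn
  have hz0 : z ≠ 0 := by
    rintro rfl
    simp at hpz
    exact absurd (norm_nonneg p) (not_le.2 hpz)
  -- solve `(z - R_p) t = y`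
  have hUz : IsUnit (1 - z⁻¹ • Rm J p) := by
    apply isUnit_one_sub_of_norm_lt_one
    rw [norm_smul, norm_inv, inv_mul_lt_one₀ (norm_pos_iff.2 hz0)]
    exact (norm_Rm_le _ _).trans_lt hpz
  obtain ⟨t, ht⟩ : ∃ t : V J, z • t - Rm J p t = y := by
    refine ⟨Ring.inverse (1 - z⁻¹ • Rm J p) (z⁻¹ • y), ?_⟩
    have := congrArg (fun T : V J →L[ℂ] V J => T (z⁻¹ • y)) (Ring.mul_inverse_cancel _ hUz)
    simp only [mul_apply_eq_comp, sub_apply,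
      one_apply_eq_self, smul_apply] at this
    have := congrArg (fun v => z • v) this
    simpa only [smul_sub, smul_smul, mul_inv_cancel₀ hz0, one_smul] using this
  set y' : V J := t - z • Rm J (star p) t with hy'
  have hcomm : z • y' - Rm J p y' = y - z • Rm J (star p) y := by
    rw [← ht, hy']
    apply ofV_inj
    have e : star p * p = p * star p := (Quaternion.star_mul_self p).trans (Quaternion.self_mul_star p).symm
    simp only [ofV_smul, ofV_Rm, ofV_sub, mul_sub, sub_mul, mul_assoc, e]
    abel
  set y'' := Ring.inverse (1 - Rm J (star w) * A) y' with hy''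
  have h2 : y'' - Rm J (star w) (A y'') = y' := by
    have := congrArg (fun T : V J →L[ℂ] V J => T y') (Ring.mul_inverse_cancel _ hU.2)
    simpa only [mul_apply_eq_comp, sub_apply,
      one_apply_eq_self] using this
  have hTh : Theta J a p z y = A y'' - Rm J w y'' := by
    have e1 := congrArg (fun T : V J →L[ℂ] V J => T y) (Theta_spec J ha hp hz)
    have e2 : (1 - A * Rm J (star w)) (A y'' - Rm J w y'') =
        (Op J (diffQuotC a p) z * (1 - z • Rm J (star p))) y := by
      simp only [mul_apply_eq_comp, sub_apply,
        one_apply_eq_self, smul_apply]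
      rw [← hcomm, Op_diffQuot J ha.1.good hp hz, ← h2]
      simp only [map_sub]
      have : Rm J (star w) (Rm J w y'') = Rm J w (Rm J (star w) y'') := by
        apply ofV_inj
        simp only [ofV_Rm, mul_assoc, Quaternion.star_mul_self, Quaternion.self_mul_star]
      have h3 : A (Rm J (star w) (Rm J w y'')) = Rm J w (Rm J (star w) (A y'')) := by
        have k1 : Rm J (star w) (Rm J w y'') = ((Quaternion.normSq w : ℝ) : ℂ) • y'' := by
          apply ofV_inj
          rw [ofV_smul, ofV_Rm, ofV_Rm, mul_assoc, Quaternion.self_mul_star]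
          rw [show iot J ((Quaternion.normSq w : ℝ) : ℂ) = ((Quaternion.normSq w : ℝ) : H) by
            rw [iot_apply]; simp]
          exact (Quaternion.coe_commutes _ _).symm
        have k2 : Rm J w (Rm J (star w) (A y'')) = ((Quaternion.normSq w : ℝ) : ℂ) • (A y'') := by
          apply ofV_inj
          rw [ofV_smul, ofV_Rm, ofV_Rm, mul_assoc, Quaternion.star_mul_self]
          rw [show iot J ((Quaternion.normSq w : ℝ) : ℂ) = ((Quaternion.normSq w : ℝ) : H) by
            rw [iot_apply]; simp]
          exact (Quaternion.coe_commutes _ _).symm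
        rw [k1, k2, map_smul]
      rw [h3]
      abel
    have e3 : (1 - A * Rm J (star w)) (Theta J a p z y) =
       (1 - A * Rm J (star w)) (A y'' - Rm J w y'') := e1.trans e2.symm
    have e4 := congrArg (fun v => Ring.inverse ((1 : V J →L[ℂ] V J) - A * Rm J (star w)) v) e3
    have inj : ∀ v, Ring.inverse ((1 : V J →L[ℂ] V J) - A * Rm J (star w)) ((1 - A * Rm J (star w)) v) = v := fun v => by
      have := congrArg (fun T : V J →L[ℂ] V J => T v) (Ring.inverse_mul_cancel _ hU.1)
      simpa only [mul_apply_eq_comp, one_apply_eq_self] using this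
    simpa only [inj] using e4
  have b1 : ‖Theta J a p z y‖ ≤ ‖y'‖ := by
    rw [hTh, ← h2]
    exact contr J A hA w hwn y''
  refine b1.trans ?_
  have b2 := key_eq (ofV (z • t)) (ofV t) p
  have b3 : ‖y'‖ ^ 2 - ‖y‖ ^ 2 = (1 - ‖p‖ ^ 2) * (‖t‖ ^ 2 - (‖z‖ * ‖t‖) ^ 2) := by
    rw [← norm_smul, ← ht]
    have : y' = t - Rm J (star p) (z • t) := by rw [hy', map_smul]
    rw [this]
    exact b2
  have b4 : (‖z‖ - ‖p‖) * ‖t‖ ≤ ‖y‖ := by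
    rw [← ht]
    have := norm_sub_norm_le (z • t) (Rm J p t)
    have k : ‖Rm J p t‖ = ‖t‖ * ‖p‖ := norm_mul (ofV t) p
    rw [norm_smul, k] at this
    linarith
  have hd : 0 < ‖z‖ - ‖p‖ := sub_pos.2 hpz
  have b5 : ‖t‖ ^ 2 ≤ ‖y‖ ^ 2 / (‖z‖ - ‖p‖) ^ 2 := by
    rw [le_div_iff₀ (by positivity), ← mul_pow]
    gcongr
    linarith
  have c1 : 0 ≤ 1 - ‖p‖ ^ 2 := by nlinarith [norm_nonneg p]
  have c2 : 0 ≤ 1 - ‖z‖ ^ 2 := by nlinarith [norm_nonneg z]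
  rw [← sq_le_sq₀ (norm_nonneg _) (mul_nonneg (by unfold Kf; exact Real.sqrt_nonneg _) (norm_nonneg _)), mul_pow, Kf, Real.sq_sqrt (by positivity)]
  have : ‖y'‖ ^ 2 = ‖y‖ ^ 2 + (1 - ‖p‖ ^ 2) * (1 - ‖z‖ ^ 2) * ‖t‖ ^ 2 := by linarith
  rw [this]
  calc _ ≤ ‖y‖ ^ 2 + (1 - ‖p‖ ^ 2) * (1 - ‖z‖ ^ 2) * (‖y‖ ^ 2 / (‖z‖ - ‖p‖) ^ 2) := by gcongr
    _ = _ := by ring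

theorem Theta_le_one (J : ImU) {a : ℕ → H} (ha : SelfMap a) {p : H} (hp : ‖p‖ < 1) {z : ℂ}
    (hz : ‖z‖ < 1) : ‖Theta J a p z‖ ≤ 1 := by
  have hlim : Tendsto (Kf ‖p‖) (𝓝[<] 1) (𝓝 1) := by
    have : ContinuousAt (Kf ‖p‖) 1 := by
      unfold Kf
      have : (1 - ‖p‖) ^ 2 ≠ 0 := pow_ne_zero _ (sub_pos.2 hp).ne'
      fun_prop (disch := assumption)
    have h := this.tendsto
    rw [show Kf ‖p‖ 1 = 1 by simp [Kf]] at h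
    exact h.mono_left nhdsWithin_le_nhds
  refine ge_of_tendsto hlim ?_
  have : Set.Ioo (max ‖p‖ ‖z‖) 1 ∈ 𝓝[<] (1 : ℝ) := Ioo_mem_nhdsLT (max_lt hp hz)
  filter_upwards [this] with ρ hρ
  obtain ⟨h1, h2⟩ := hρ
  obtain ⟨hpρ, hzρ⟩ := max_lt_iff.1 h1
  have hρ0 : ρ ≠ 0 := ((norm_nonneg z).trans_lt hzρ).ne'
  refine Complex.norm_le_of_forall_mem_frontier_norm_le (U := Metric.ball 0 ρ) Metric.isBounded_ball
    ?_ ?_ (subset_closure (by simpa using hzρ))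
  · apply DifferentiableOn.diffContOnCl
    refine (Theta_diff J ha hp).mono ?_
    rw [closure_ball _ hρ0]
    exact Metric.closedBall_subset_ball h2
  · intro ξ hξ
    rw [frontier_ball _ hρ0, mem_sphere_zero_iff_norm] at hξ
    have := Theta_bound J ha hp (z := ξ) (by rwa [hξ]) (by rwa [hξ])
    rwa [hξ] at this

theorem iot_real (J : ImU) (t : ℝ) : iot J (t : ℂ) = (t : H) := by
  rw [iot_apply]; simp

theorem good_of_summable {b : ℕ → H}
    (h : ∀ ρ : ℝ, 0 ≤ ρ → ρ < 1 → Summable fun k => (ρ : H) ^ k * b k) : Good b := by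
  intro ρ h0 h1
  have := h ρ h0 h1
  rw [← summable_norm_iff] at this
  simpa [abs_of_nonneg h0] using this

theorem Good.summ {b : ℕ → H} (h : Good b) {t : ℝ} (ht : |t| < 1) :
    Summable fun k => ‖(t : H) ^ k * b k‖ := by
  simpa [norm_mul, norm_pow] using h |t| (abs_nonneg _) ht

theorem Good.hasSum {b : ℕ → H} (h : Good b) {t : ℝ} (ht : |t| < 1) :
    HasSum (fun k => (t : H) ^ k * b k) (evalC b t) := (h.summ ht).of_norm.hasSum

theorem hs_congr {f g : ℕ → H} {x : H} (h : HasSum f x) (e : ∀ k, g k = f k) : HasSum g x := by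
  rw [funext e]; exact h

def serF (d : ℕ → H) : FormalMultilinearSeries ℝ ℝ H :=
  fun n => ContinuousMultilinearMap.mkPiRing ℝ (Fin n) (d n)

theorem serF_coeff (d : ℕ → H) (n : ℕ) : (serF d).coeff n = d n := by
  simp [serF, FormalMultilinearSeries.coeff]

theorem series_unique {b c : ℕ → H} (hb : Good b) (hc : Good c)
    (h : ∀ t : ℝ, |t| < 1 → evalC b t = evalC c t) : b = c := by
  have key : ∀ d : ℕ → H, Good d → (∀ t : ℝ, |t| < 1 → evalC d t = evalC b t) →
      HasFPowerSeriesAt (fun t : ℝ => evalC b t)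
        (serF d) (0 : ℝ) := by
    intro d hd hdb
    refine hasFPowerSeriesAt_iff.2 ?_
    have : Metric.ball (0 : ℝ) 1 ∈ 𝓝 (0 : ℝ) := Metric.ball_mem_nhds _ one_pos
    filter_upwards [this] with t ht
    rw [mem_ball_zero_iff, Real.norm_eq_abs] at ht
    rw [zero_add, ← hdb t ht]
    refine hs_congr (hd.hasSum ht) fun n => ?_
    rw [serF_coeff, ← Quaternion.coe_pow, Quaternion.coe_mul_eq_smul]
  have e := (key b hb fun _ _ => rfl).eq_formalMultilinearSeries (key c hc fun t ht => (h t ht).symm)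
  ext1 n
  have := congrArg (fun P : FormalMultilinearSeries ℝ ℝ H => P.coeff n) e
  simpa [serF_coeff] using this

theorem starMulC_eq (b c : ℕ → H) (m : ℕ) :
    starMulC b c m = ∑ kl ∈ Finset.HasAntidiagonal.antidiagonal m, b kl.1 * c kl.2 := by
  rw [← Finset.Nat.sum_antidiagonal_swap, Finset.Nat.sum_antidiagonal_eq_sum_range_succ_mk]
  rfl

theorem mk_starMulC (b c : ℕ → H) :
    PowerSeries.mk (starMulC b c) = PowerSeries.mk b * PowerSeries.mk c := by
  ext1 m
  simp [PowerSeries.coeff_mul, starMulC_eq]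

theorem term_eq (b c : ℕ → H) (t : ℝ) (m : ℕ) :
    ∑ kl ∈ Finset.HasAntidiagonal.antidiagonal m, ((t : H) ^ kl.1 * b kl.1) * ((t : H) ^ kl.2 * c kl.2) =
      (t : H) ^ m * starMulC b c m := by
  rw [starMulC_eq, Finset.mul_sum]
  refine Finset.sum_congr rfl fun kl hkl => ?_
  rw [← Finset.HasAntidiagonal.mem_antidiagonal.1 hkl, pow_add]
  simp only [← Quaternion.coe_pow, Quaternion.coe_mul_eq_smul, smul_mul_smul_comm]
  rw [smul_mul_assoc, Quaternion.coe_mul_eq_smul, smul_smul]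

theorem good_starMulC {b c : ℕ → H} (hb : Good b) (hc : Good c) : Good (starMulC b c) := by
  apply good_of_summable
  intro ρ h0 h1
  have h : |ρ| < 1 := by rwa [abs_of_nonneg h0]
  have := summable_norm_sum_mul_antidiagonal_of_summable_norm (hb.summ h) (hc.summ h)
  simp only [term_eq] at this
  exact this.of_norm

theorem evalC_starMulC {b c : ℕ → H} (hb : Good b) (hc : Good c) {t : ℝ} (ht : |t| < 1) :
    evalC (starMulC b c) t = evalC b t * evalC c t := by
  unfold evalC
  rw [tsum_mul_tsum_eq_tsum_sum_antidiagonal_of_summable_norm (hb.summ ht) (hc.summ ht)]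
  simp only [term_eq]

theorem hasSum_omq (p : H) (t : ℝ) :
    HasSum (fun k => (t : H) ^ k * oneMinusQPbarC p k) (1 - (t : H) * star p) := by
  have : (1 - (t : H) * star p) = ∑ k ∈ Finset.range 2, (t : H) ^ k * oneMinusQPbarC p k := by
    simp [Finset.sum_range_succ, oneMinusQPbarC, sub_eq_add_neg]
  rw [this]
  apply hasSum_sum_of_ne_finset_zero
  intro b hb
  have h0 : b ≠ 0 := by rintro rfl; simp at hb
  have h1 : b ≠ 1 := by rintro rfl; simp at hb
  simp [oneMinusQPbarC, h0, h1]

theorem hasSum_den {a : ℕ → H} (ha : Good a) (w : H) {t : ℝ} (ht : |t| < 1) :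
    HasSum (fun k => (t : H) ^ k * ((if k = 0 then (1 : H) else 0) - w * a k))
      (1 - w * evalC a t) := by
  have h1 : HasSum (fun k => (t : H) ^ k * (if k = 0 then (1 : H) else 0)) 1 := by
    convert hasSum_ite_eq 0 (1 : H) using 2 with k
    by_cases h : k = 0 <;> simp [h]
  have h2 := (ha.hasSum ht).mul_left w
  refine hs_congr (h1.sub h2) fun k => ?_
  rw [mul_sub, ← mul_assoc, ← mul_assoc, ← Quaternion.coe_pow, Quaternion.coe_commutes _ w]

theorem starInvC_spec {b : ℕ → H} (hb : b 0 ≠ 0) :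
    PowerSeries.mk b * PowerSeries.mk (starInvC b) = 1 := by
  rw [← mk_starMulC]
  ext1 m
  rw [PowerSeries.coeff_mk, PowerSeries.coeff_one]
  cases m with
  | zero => simp [starMulC, starInvC, hb]
  | succ m =>
    rw [starMulC, Finset.sum_range_succ, starInvC, Finset.sum_range]
    simp only [Nat.sub_self, neg_mul, mul_neg, mul_inv_cancel_left₀ hb]
    simp

theorem exists_series (J : ImU) {a : ℕ → H} (ha : SelfMap a) {p : H} (hp : ‖p‖ < 1) :
    ∃ x : ℕ → H, ∀ z : ℂ, ‖z‖ < 1 →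
      HasSum (fun n => iot J z ^ n * x n) (ofV (Theta J a p z (toV J 1))) := by
  set f : ℂ → V J := fun z => Theta J a p z (toV J 1) with hf
  have hd : DifferentiableOn ℂ f (Metric.ball 0 1) :=
    (Theta_diff J ha hp).clm_apply (differentiableOn_const _)
  refine ⟨fun n => ofV (((n.factorial : ℂ))⁻¹ • iteratedDeriv n f 0), fun z hz => ?_⟩
  have h := Complex.hasSum_taylorSeries_on_ball hd (z := z) (by simpa using hz)
  have h2 := h.map (ofVHom J) continuous_ofV
  refine hs_congr h2 fun n => ?_
  change _ = ofV (((n.factorial : ℂ))⁻¹ • (z - 0) ^ n • iteratedDeriv n f 0)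
  rw [smul_comm, sub_zero, ofV_smul _ (_ • _), map_pow]

theorem Op_real (J : ImU) {a : ℕ → H} (ha : Good a) {t : ℝ} (ht : |t| < 1) (y : V J) :
    ofV (Op J a t y) = ofV y * evalC a t := by
  have h := Op_apply_hasSum J ha (z := (t : ℂ)) (by simpa using ht) y
  refine h.unique ?_
  refine hs_congr ((ha.hasSum ht).mul_left (ofV y)) fun k => ?_
  rw [iot_real, ← mul_assoc, ← mul_assoc, ← Quaternion.coe_pow, Quaternion.coe_commutes _ (ofV y)]

theorem hdq_eval (J : ImU) {a : ℕ → H} (ha : SelfMap a) (h0 : a 0 = 0) {p : H} (hp : ‖p‖ < 1)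
    {z : ℂ} (hz : ‖z‖ < 1) :
    evalC (hdqC a p) (iot J z) = ofV (Theta J a p z (toV J 1)) := by
  obtain ⟨x, hx⟩ := exists_series J ha hp
  have hxr : ∀ t : ℝ, |t| < 1 →
      HasSum (fun k => (t : H) ^ k * x k) (ofV (Theta J a p t (toV J 1))) := by
    intro t ht
    have := hx (t : ℂ) (by simpa using ht)
    rwa [iot_real] at this
  have gx : Good x := good_of_summable fun ρ h0 h1 => (hxr ρ (by rwa [abs_of_nonneg h0])).summable
  have ga := ha.1.good
  have gR := diffQuot_good ga hp
  set w := evalC a p with hw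
  have gd : Good (fun k => (if k = 0 then (1 : H) else 0) - star w * a k) :=
    good_of_summable fun ρ h0 h1 => (hasSum_den ga (star w) (by rwa [abs_of_nonneg h0])).summable
  have go : Good (oneMinusQPbarC p) := good_of_summable fun ρ h0 h1 => (hasSum_omq p ρ).summable
  have e : starMulC x (fun k => (if k = 0 then (1 : H) else 0) - star w * a k) =
      starMulC (oneMinusQPbarC p) (diffQuotC a p) := by
    refine series_unique (good_starMulC gx gd) (good_starMulC go gR) fun t ht => ?_
    rw [evalC_starMulC gx gd ht, evalC_starMulC go gR ht]
    have e1 : evalC (fun k => (if k = 0 then (1 : H) else 0) - star w * a k) t =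
      1 - star w * evalC a t := (hasSum_den ga (star w) ht).tsum_eq
    have e2 : evalC (oneMinusQPbarC p) t = 1 - (t : H) * star p := (hasSum_omq p t).tsum_eq
    have e3 : evalC x t = ofV (Theta J a p t (toV J 1)) := (hxr t ht).tsum_eq
    rw [e1, e2, e3]
    have s := congrArg (fun T : V J →L[ℂ] V J => ofV (T (toV J 1)))
      (Theta_spec J ha hp (z := (t : ℂ)) (by simpa using ht))
    simp only [mul_apply_eq_comp, sub_apply, one_apply_eq_self, smul_apply, ofV_sub, Op_real J ga ht,
      Op_real J gR ht, ofV_Rm, ofV_smul, iot_real, ofV_toV, one_mul] at s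
    rw [← s, mul_sub, mul_one, mul_assoc]
  have e' : x = hdqC a p := by
    have k := congrArg PowerSeries.mk e
    rw [mk_starMulC] at k
    have k2 : PowerSeries.mk x = PowerSeries.mk (hdqC a p) := by
      rw [hdqC, mk_starMulC, ← k, mul_assoc, starInvC_spec (by simp [h0]), mul_one]
    ext1 n
    simpa using congrArg (PowerSeries.coeff n) k2
  rw [← e']
  exact (hx z hz).tsum_eq

theorem Theta_zero (J : ImU) {a : ℕ → H} (ha : SelfMap a) (h0 : a 0 = 0) {p : H} (hp : ‖p‖ < 1) :
    Theta J a p 0 = Rm J (diffQuotC a p 0) := by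
  have s := Theta_spec J ha hp (z := 0) (by simp)
  have gR := diffQuot_good ha.1.good hp
  have ev : ∀ b : ℕ → H, Good b → Op J b 0 = Rm J (b 0) := by
    intro b hb
    have h := Op_hasSum J hb (z := 0) (by simp)
    have h2 := hasSum_single (f := fun k => (0 : ℂ) ^ k • Rm J (b k)) 0 (by
      intro k hk; simp [hk])
    simpa using h.unique h2
  rw [ev a ha.1.good, ev _ gR, h0] at s
  have : Rm J 0 = 0 := by
    ext y
    exact mul_zero (ofV y)
  simpa [this] using s

theorem schwarz_pick (J : ImU) {a : ℕ → H} (ha : SelfMap a) (h0 : a 0 = 0) {p : H} (hp : ‖p‖ < 1)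
    {z : ℂ} (hz : ‖z‖ < 1) :
    ‖evalC (hdqC a p) (iot J z) - diffQuotC a p 0‖ ≤
      ‖z‖ * ‖1 - evalC (hdqC a p) (iot J z) * star (diffQuotC a p 0)‖ := by
  rw [hdq_eval J ha h0 hp hz]
  set c := diffQuotC a p 0 with hc
  set X := ofV (Theta J a p z (toV J 1)) with hX
  have hcn : ‖c‖ ≤ 1 := by
    have h1 := Theta_le_one J ha hp (z := 0) (by simp)
    rw [Theta_zero J ha h0 hp] at h1
    have h2 := (Rm J c).le_of_opNorm_le h1 (toV J 1)
    have h3 : ‖Rm J c (toV J 1)‖ = ‖c‖ := congrArg norm (one_mul c)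
    have h4 : ‖toV J 1‖ = 1 := norm_one (α := H)
    rwa [h3, h4, one_mul] at h2
  have main : ∀ t : ℝ, 0 < t → t < 1 → ‖(t : H) * X - (t : H) * c‖ ≤
      ‖z‖ * ‖1 - ((t : H) * X) * star ((t : H) * c)‖ := by
    intro t ht0 ht1
    set d : H := (t : H) * c with hd
    have hdn : ‖d‖ < 1 := by
      rw [hd, norm_mul, Quaternion.norm_coe, Real.norm_eq_abs, abs_of_pos ht0]
      nlinarith [norm_nonneg c]
    set T : ℂ → V J →L[ℂ] V J := fun ξ => (t : ℂ) • Theta J a p ξ with hT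
    have hTn : ∀ ξ : ℂ, ‖ξ‖ < 1 → ‖T ξ‖ ≤ 1 := by
      intro ξ hξ
      rw [hT]
      simp only [norm_smul, Complex.norm_real, Real.norm_eq_abs, abs_of_pos ht0]
      have := Theta_le_one J ha hp hξ
      nlinarith [norm_nonneg (Theta J a p ξ)]
    have hTd : DifferentiableOn ℂ T (Metric.ball 0 1) := (Theta_diff J ha hp).const_smul (t : ℂ)
    have hT0 : T 0 = Rm J d := by
      simp only [hT]
      rw [Theta_zero J ha h0 hp]
      ext y
      apply ofV_inj
      rw [smul_apply, ofV_smul, ofV_Rm, ofV_Rm, iot_real, hd, ← mul_assoc, ← mul_assoc,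
        Quaternion.coe_commutes]
    set S : ℂ → V J →L[ℂ] V J := fun ξ => (T ξ - Rm J d) * Ring.inverse (1 - Rm J (star d) * T ξ)
      with hS
    have hSd : DifferentiableOn ℂ S (Metric.ball 0 1) := by
      refine (hTd.sub (differentiableOn_const _)).mul ?_
      have h1 : DifferentiableOn ℂ (fun ξ => 1 - Rm J (star d) * T ξ) (Metric.ball 0 1) :=
        (differentiableOn_const _).sub ((differentiableOn_const _).mul hTd)
      intro ξ hξ
      have := (unit1 J (T ξ) (hTn ξ (mem_ball_zero_iff.1 hξ)) d hdn).2
      exact (differentiableAt_inverse this).comp_differentiableWithinAt ξ (h1 ξ hξ)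
    have hSn : ∀ ξ : ℂ, ‖ξ‖ < 1 → ‖S ξ‖ ≤ 1 := by
      intro ξ hξ
      have hu := (unit1 J (T ξ) (hTn ξ hξ) d hdn).2
      refine ContinuousLinearMap.opNorm_le_bound _ zero_le_one fun y => ?_
      rw [one_mul]
      set v := Ring.inverse (1 - Rm J (star d) * T ξ) y with hv
      have e : v - Rm J (star d) (T ξ v) = y := by
        have := congrArg (fun T : V J →L[ℂ] V J => T y) (Ring.mul_inverse_cancel _ hu)
        simpa only [mul_apply_eq_comp, sub_apply, one_apply_eq_self] using this
      have e2 : S ξ y = T ξ v - Rm J d v := by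
        simp only [hS, mul_apply_eq_comp, sub_apply, hv]
      rw [e2]
      have := contr J (T ξ) (hTn ξ hξ) d hdn v
      rwa [e] at this
    have hS0 : S 0 = 0 := by simp [hS, hT0]
    have hb : ‖S z‖ ≤ ‖z‖ := by
      refine Complex.norm_le_norm_of_mapsTo_ball hSd ?_ hS0 hz
      intro ξ hξ
      simpa using hSn ξ (mem_ball_zero_iff.1 hξ)
    have hu := (unit1 J (T z) (hTn z hz) d hdn).2
    have e : S z * (1 - Rm J (star d) * T z) = T z - Rm J d := by
      simp only [hS]
      rw [mul_assoc, Ring.inverse_mul_cancel _ hu, mul_one]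
    have e2 := congrArg (fun T : V J →L[ℂ] V J => T (toV J 1)) e
    simp only [mul_apply_eq_comp, sub_apply, one_apply_eq_self] at e2
    have hTz : ofV (T z (toV J 1)) = (t : H) * X := by
      simp only [hT, smul_apply, ofV_smul, iot_real, hX]
    have n1 : ‖T z (toV J 1) - Rm J d (toV J 1)‖ = ‖(t : H) * X - d‖ := by
      rw [← norm_ofV, ofV_sub, hTz, ofV_Rm, ofV_toV, one_mul]
    have n2 : ‖toV J 1 - Rm J (star d) (T z (toV J 1))‖ = ‖1 - (t : H) * X * star d‖ := by
      rw [← norm_ofV, ofV_sub, ofV_Rm, hTz, ofV_toV]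
    rw [← n1, ← n2, ← e2]
    exact (S z).le_of_opNorm_le hb _
  have l1 : Tendsto (fun t : ℝ => ‖(t : H) * X - (t : H) * c‖) (𝓝[<] 1) (𝓝 ‖X - c‖) := by
    have : Continuous (fun t : ℝ => ‖(t : H) * X - (t : H) * c‖) := by
      have := Quaternion.continuous_coe
      fun_prop
    have h := this.tendsto 1
    simp only [Quaternion.coe_one, one_mul] at h
    exact h.mono_left nhdsWithin_le_nhds
  have l2 : Tendsto (fun t : ℝ => ‖z‖ * ‖1 - ((t : H) * X) * star ((t : H) * c)‖) (𝓝[<] 1)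
      (𝓝 (‖z‖ * ‖1 - X * star c‖)) := by
    have : Continuous (fun t : ℝ => ‖z‖ * ‖1 - ((t : H) * X) * star ((t : H) * c)‖) := by
      have := Quaternion.continuous_coe
      fun_prop
    have h := this.tendsto 1
    simp only [Quaternion.coe_one, one_mul] at h
    exact h.mono_left nhdsWithin_le_nhds
  refine le_of_tendsto_of_tendsto l1 l2 ?_
  filter_upwards [Ioo_mem_nhdsLT (zero_lt_one (α := ℝ))] with t ht
  exact main t ht.1 ht.2

theorem final_alg (X c : H) (r : ℝ) (hr0 : 0 < r) (hr : r < 1) (hc : ‖c‖ ≤ 1)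
    (h : ‖X - c‖ ≤ r * ‖1 - X * star c‖) :
    ‖((1 - (r * ‖c‖) ^ 2) / (1 - r ^ 2)) • X - c‖ ≤
      (r ^ 2 - (r * ‖c‖) ^ 2) / (r * (1 - r ^ 2)) := by
  have hr2 : 0 < 1 - r ^ 2 := by nlinarith
  have hs2 : 0 ≤ 1 - ‖c‖ ^ 2 := by nlinarith [norm_nonneg c]
  obtain ⟨D, h1, h2, h3⟩ : ∃ D : ℝ, ‖X - c‖ ^ 2 = ‖X‖ ^ 2 - 2 * D + ‖c‖ ^ 2 ∧
      ‖1 - X * star c‖ ^ 2 = 1 - 2 * D + ‖X‖ ^ 2 * ‖c‖ ^ 2 ∧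
      ∀ α : ℝ, ‖α • X - c‖ ^ 2 = α ^ 2 * ‖X‖ ^ 2 - 2 * α * D + ‖c‖ ^ 2 := by
    refine ⟨X.re * c.re + X.imI * c.imI + X.imJ * c.imJ + X.imK * c.imK, ?_, ?_, ?_⟩
    · simp only [← nsq, Quaternion.normSq_def']
      simp
      ring
    · simp only [← nsq, Quaternion.normSq_def', Quaternion.re_sub, Quaternion.imI_sub,
        Quaternion.imJ_sub, Quaternion.imK_sub, Quaternion.re_one, Quaternion.imI_one,
        Quaternion.imJ_one, Quaternion.imK_one]
      simp
      ring
    · intro α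
      simp only [← nsq, Quaternion.normSq_def']
      simp
      ring
  have hsq : ‖X - c‖ ^ 2 ≤ r ^ 2 * ‖1 - X * star c‖ ^ 2 := by
    rw [← mul_pow]; gcongr
  rw [h1, h2] at hsq
  have hR : (r ^ 2 - (r * ‖c‖) ^ 2) / (r * (1 - r ^ 2)) = r * (1 - ‖c‖ ^ 2) / (1 - r ^ 2) := by
    field_simp
  rw [hR]
  refine (sq_le_sq₀ (norm_nonneg _) (by positivity)).1 ?_
  rw [h3]
  set N := ‖X‖ ^ 2
  set s := ‖c‖
  have hA : 0 < 1 - (r * s) ^ 2 := by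
    have : (r * s) ^ 2 ≤ r ^ 2 := by
      rw [mul_pow]; nlinarith [sq_nonneg r]
    linarith
  have e : (r * (1 - s ^ 2) / (1 - r ^ 2)) ^ 2 -
      (((1 - (r * s) ^ 2) / (1 - r ^ 2)) ^ 2 * N - 2 * ((1 - (r * s) ^ 2) / (1 - r ^ 2)) * D + s ^ 2)
      = (1 - (r * s) ^ 2) / (1 - r ^ 2) ^ 2 *
        (r ^ 2 * (1 - 2 * D + N * s ^ 2) - (N - 2 * D + s ^ 2)) := by
    field_simp
    ring
  have : 0 ≤ (1 - (r * s) ^ 2) / (1 - r ^ 2) ^ 2 *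
        (r ^ 2 * (1 - 2 * D + N * s ^ 2) - (N - 2 * D + s ^ 2)) :=
    mul_nonneg (by positivity) (by linarith)
  linarith

/-- Quaternionic Dieudonné estimate: for a slice regular self-map `f` of `𝔹`
with `f(0) = 0` and `q₀ ∈ 𝔹 \ {0}`, setting `α = (1 − |f(q₀)|²)/(1 − |q₀|²)`,
`|α f^h(q₀) − q₀⁻¹ f(q₀)| ≤ (|q₀|² − |f(q₀)|²)/(|q₀|(1 − |q₀|²))`. -/
theorem dieudonne_estimate (a : ℕ → H) (ha : SelfMap a) (h0 : evalC a 0 = 0)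
    (q₀ : H) (hq₀ : ‖q₀‖ < 1) (hne : q₀ ≠ 0) :
    ‖((1 - ‖evalC a q₀‖ ^ 2) / (1 - ‖q₀‖ ^ 2)) • evalC (hdqC a q₀) q₀ -
        q₀⁻¹ * evalC a q₀‖ ≤
      (‖q₀‖ ^ 2 - ‖evalC a q₀‖ ^ 2) / (‖q₀‖ * (1 - ‖q₀‖ ^ 2)) := by
  have ha0 : a 0 = 0 := by
    have : evalC a 0 = a 0 := by
      unfold evalC
      rw [tsum_eq_single 0]
      · simp
      · intro k hk; simp [hk]
    rw [← this, h0]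
  obtain ⟨J, z, hz⟩ := exists_iot q₀
  have hzn : ‖z‖ = ‖q₀‖ := by rw [← hz, norm_iot]
  have hd := diffQuot_zero ha.1.good hq₀
  rw [ha0, zero_add] at hd
  have hc : q₀⁻¹ * evalC a q₀ = diffQuotC a q₀ 0 := by
    rw [hd, inv_mul_cancel_left₀ hne]
  have hcn : ‖diffQuotC a q₀ 0‖ ≤ 1 := by
    have h1 := Theta_le_one J ha hq₀ (z := 0) (by simp)
    rw [Theta_zero J ha ha0 hq₀] at h1
    have h2 := (Rm J (diffQuotC a q₀ 0)).le_of_opNorm_le h1 (toV J 1)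
    have h3 : ‖Rm J (diffQuotC a q₀ 0) (toV J 1)‖ = ‖diffQuotC a q₀ 0‖ := congrArg norm (one_mul (diffQuotC a q₀ 0))
    have h4 : ‖toV J 1‖ = 1 := norm_one (α := H)
    rwa [h3, h4, one_mul] at h2
  have sp := schwarz_pick J ha ha0 hq₀ (z := z) (by rwa [hzn])
  rw [hz, hzn] at sp
  have hw : ‖evalC a q₀‖ = ‖q₀‖ * ‖diffQuotC a q₀ 0‖ := by rw [hd, norm_mul]
  rw [hc, hw]
  exact final_alg _ _ _ (norm_pos_iff.2 hne) hq₀ hcn sp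

end QPaper
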